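/- In the design-based stratified setup under Assumption 1, with m ≥ 2, the Imai variance estimator V̂^IM_n = (1/(m(m−1)))Σ_{j=1}^m (Δ̂_{j,n} − Δ̂_n)² satisfies E[V̂^IM_n] − Var[Δ̂_n] = (1/(m(m−1)))Σ_{j=1}^m (Δ_{j,n} − Δ_n)² ≥ 0, where Δ_{j,n} = (1/k)Σ_{i∈λ_j}(Y_i(1) − Y_i(0)) and Δ_n = (1/n)Σ_{i=1}^n (Y_i(1) − Y_i(0)). In particular V̂^IM_n is an upward-biased estimator of Var[Δ̂_n]. -/

import Mathlib

open MeasureTheory ProbabilityTheory Filter Finset Topology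

noncomputable section

namespace DesignBased

/-- The uniform (probability) measure on a finite set of outcomes. -/
def uniformFinset {α : Type*} [MeasurableSpace α] (S : Finset α) : Measure α :=
  ((S.card : ENNReal))⁻¹ • ∑ d ∈ S, Measure.dirac d

/-- Assignment vectors for a stratum of size `k` with exactly `ℓ` treated units. -/
def assignSet (k ℓ : ℕ) : Finset (Fin k → Bool) :=
  Finset.univ.filter fun d => (Finset.univ.filter fun i => d i = true).card = ℓ

/-- Assumption 1: the treatment assignment `D` is distributed as the product, over the `m`
strata, of the uniform distribution on assignment vectors with exactly `ℓ` treated units. -/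
def Assumption1 {Ω : Type*} [MeasurableSpace Ω] (P : Measure Ω) (m k ℓ : ℕ)
    (D : Ω → Fin m → Fin k → Bool) : Prop :=
  Measurable D ∧
    Measure.map D P = Measure.pi fun _ : Fin m => uniformFinset (assignSet k ℓ)

variable {Ω : Type*}

/-- The difference-in-means estimator. -/
def hatDelta (m k ℓ : ℕ) (Y1 Y0 : Fin m → Fin k → ℝ)
    (D : Ω → Fin m → Fin k → Bool) (ω : Ω) : ℝ :=
  ((m : ℝ) * ℓ)⁻¹ * ∑ j, ∑ i, (if D ω j i then Y1 j i else 0)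
    - ((m : ℝ) * ((k : ℝ) - ℓ))⁻¹ * ∑ j, ∑ i, (if D ω j i then 0 else Y0 j i)

/-- The finite population average treatment effect. -/
def Delta (m k : ℕ) (Y1 Y0 : Fin m → Fin k → ℝ) : ℝ :=
  ((m : ℝ) * k)⁻¹ * ∑ j, ∑ i, (Y1 j i - Y0 j i)

/-- The stratum-level difference-in-means estimator. -/
def hatDeltaJ (m k ℓ : ℕ) (Y1 Y0 : Fin m → Fin k → ℝ)
    (D : Ω → Fin m → Fin k → Bool) (j : Fin m) (ω : Ω) : ℝ :=
  (ℓ : ℝ)⁻¹ * ∑ i, (if D ω j i then Y1 j i else 0)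
    - ((k : ℝ) - ℓ)⁻¹ * ∑ i, (if D ω j i then 0 else Y0 j i)

/-- The stratum-level average treatment effect. -/
def DeltaJ (m k : ℕ) (Y1 Y0 : Fin m → Fin k → ℝ) (j : Fin m) : ℝ :=
  (k : ℝ)⁻¹ * ∑ i, (Y1 j i - Y0 j i)

/-- The first stratum of the `j`-th pair of strata (strata are paired adjacently). -/
def pairA (m : ℕ) (j : Fin (m / 2)) : Fin m := ⟨2 * j.1, by have := j.2; omega⟩

/-- The second stratum of the `j`-th pair of strata. -/
def pairB (m : ℕ) (j : Fin (m / 2)) : Fin m := ⟨2 * j.1 + 1, by have := j.2; omega⟩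

/-- τ̂²ₙ. -/
def tauSq (m k ℓ : ℕ) (Y1 Y0 : Fin m → Fin k → ℝ)
    (D : Ω → Fin m → Fin k → Bool) (ω : Ω) : ℝ :=
  (m : ℝ)⁻¹ * ∑ j, (hatDeltaJ m k ℓ Y1 Y0 D j ω) ^ 2

/-- κ̂ₙ. -/
def kappaHat (m k ℓ : ℕ) (Y1 Y0 : Fin m → Fin k → ℝ)
    (D : Ω → Fin m → Fin k → Bool) (ω : Ω) : ℝ :=
  2 / (m : ℝ) * ∑ j : Fin (m / 2),
    hatDeltaJ m k ℓ Y1 Y0 D (pairA m j) ω * hatDeltaJ m k ℓ Y1 Y0 D (pairB m j) ω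

/-- The paired-strata variance estimator V̂ₙ. -/
def hatV (m k ℓ : ℕ) (Y1 Y0 : Fin m → Fin k → ℝ)
    (D : Ω → Fin m → Fin k → Bool) (ω : Ω) : ℝ :=
  (m : ℝ)⁻¹ * (tauSq m k ℓ Y1 Y0 D ω - kappaHat m k ℓ Y1 Y0 D ω)

/-- The Imai variance estimator V̂ᴵᴹₙ. -/
def hatVIM (m k ℓ : ℕ) (Y1 Y0 : Fin m → Fin k → ℝ)
    (D : Ω → Fin m → Fin k → Bool) (ω : Ω) : ℝ :=
  ((m : ℝ) * ((m : ℝ) - 1))⁻¹ *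
    ∑ j, (hatDeltaJ m k ℓ Y1 Y0 D j ω - hatDelta m k ℓ Y1 Y0 D ω) ^ 2

/-- The standard normal cumulative distribution function. -/
def stdNormCDF (x : ℝ) : ℝ := ((gaussianReal 0 1) (Set.Iic x)).toReal

/-- Conditional variance of `Z` given the sub-σ-algebra `m0`. -/
def condVar' {Ω' : Type*} (m0 : MeasurableSpace Ω') {mΩ : MeasurableSpace Ω'} (P : Measure Ω')
    (Z : Ω' → ℝ) : Ω' → ℝ :=
  P[fun ω => (Z ω - (P[Z|m0]) ω) ^ 2 | m0]

theorem aux_card_pos (k ℓ : ℕ) (h : ℓ < k) : 0 < (assignSet k ℓ).card := by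
  obtain ⟨t, -, ht⟩ := Finset.exists_subset_card_eq (s := (Finset.univ : Finset (Fin k))) (n := ℓ)
    (by simpa using h.le)
  refine Finset.card_pos.mpr ⟨fun i => decide (i ∈ t), ?_⟩
  simp [assignSet, ht]

theorem aux_prob (k ℓ : ℕ) (h : ℓ < k) : IsProbabilityMeasure (uniformFinset (assignSet k ℓ)) := by
  constructor
  have := aux_card_pos k ℓ h
  simp only [uniformFinset, Measure.smul_apply, Measure.finsetSum_apply, measure_univ,
    smul_eq_mul, Finset.sum_const, nsmul_eq_mul, mul_one]
  exact ENNReal.inv_mul_cancel (by exact_mod_cast this.ne') (by simp)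

theorem aux_sum (k ℓ : ℕ) (h : ℓ < k) (i : Fin k) :
    ∑ d ∈ assignSet k ℓ, (if d i then (1 : ℝ) else 0) = (assignSet k ℓ).card * ℓ / k := by
  have key : ∀ a : Fin k, ∑ d ∈ assignSet k ℓ, (if d a then (1 : ℝ) else 0)
      = ∑ d ∈ assignSet k ℓ, (if d i then (1 : ℝ) else 0) := by
    intro a
    have hmem : ∀ d ∈ assignSet k ℓ, (fun x => d (Equiv.swap a i x)) ∈ assignSet k ℓ := by
      intro d hd
      simp only [assignSet, Finset.mem_filter, Finset.mem_univ, true_and] at hd ⊢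
      rw [← hd]
      exact Finset.card_equiv (Equiv.swap a i) (by simp)
    refine Finset.sum_bij' (fun d _ => fun x => d (Equiv.swap a i x))
      (fun d _ => fun x => d (Equiv.swap a i x)) hmem hmem ?_ ?_ ?_
    · intro d _; simp
    · intro d _; simp
    · intro d _; simp
  have tot : ∑ a : Fin k, ∑ d ∈ assignSet k ℓ, (if d a then (1 : ℝ) else 0)
      = (assignSet k ℓ).card * ℓ := by
    rw [Finset.sum_comm, ← nsmul_eq_mul, ← Finset.sum_const]
    refine Finset.sum_congr rfl fun d hd => ?_
    simp only [assignSet, Finset.mem_filter, Finset.mem_univ, true_and] at hd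
    rw [Finset.sum_boole, hd]
  rw [Finset.sum_congr rfl (fun a _ => key a)] at tot
  simp only [Finset.sum_const, Finset.card_univ, Fintype.card_fin, nsmul_eq_mul] at tot
  have hk : (k : ℝ) ≠ 0 := by
    have : 0 < k := by omega
    exact_mod_cast this.ne'
  field_simp
  linarith

theorem aux_integral (k ℓ : ℕ) (f : (Fin k → Bool) → ℝ) :
    ∫ d, f d ∂(uniformFinset (assignSet k ℓ))
      = ((assignSet k ℓ).card : ℝ)⁻¹ * ∑ d ∈ assignSet k ℓ, f d := by
  rw [uniformFinset, integral_smul_measure, integral_finsetSum_measure]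
  · simp
  · intro d _
    exact Integrable.of_finite

def auxG (k ℓ : ℕ) (y1 y0 : Fin k → ℝ) (d : Fin k → Bool) : ℝ :=
  (ℓ : ℝ)⁻¹ * ∑ i, (if d i then y1 i else 0)
    - ((k : ℝ) - ℓ)⁻¹ * ∑ i, (if d i then 0 else y0 i)

theorem aux_mean (k ℓ : ℕ) (hℓ : 0 < ℓ) (h : ℓ < k) (y1 y0 : Fin k → ℝ) :
    ∫ d, auxG k ℓ y1 y0 d ∂(uniformFinset (assignSet k ℓ))
      = (k : ℝ)⁻¹ * ∑ i, (y1 i - y0 i) := by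
  have hc : ((assignSet k ℓ).card : ℝ) ≠ 0 := by exact_mod_cast (aux_card_pos k ℓ h).ne'
  have hl : (ℓ : ℝ) ≠ 0 := by exact_mod_cast hℓ.ne'
  have hk : (k : ℝ) ≠ 0 := by
    have : 0 < k := by omega
    exact_mod_cast this.ne'
  have hkl : (k : ℝ) - ℓ ≠ 0 := by
    have : (ℓ : ℝ) < k := by exact_mod_cast h
    linarith
  rw [aux_integral]
  have e1 : ∑ d ∈ assignSet k ℓ, ∑ i, (if d i then y1 i else 0)
      = (assignSet k ℓ).card * ℓ / k * ∑ i, y1 i := by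
    rw [Finset.sum_comm, Finset.mul_sum]
    refine Finset.sum_congr rfl fun i _ => ?_
    rw [← aux_sum k ℓ h i, Finset.sum_mul]
    refine Finset.sum_congr rfl fun d _ => ?_
    split_ifs <;> simp
  have e0 : ∑ d ∈ assignSet k ℓ, ∑ i, (if d i then 0 else y0 i)
      = ((assignSet k ℓ).card - (assignSet k ℓ).card * ℓ / k) * ∑ i, y0 i := by
    rw [Finset.sum_comm, Finset.mul_sum]
    refine Finset.sum_congr rfl fun i _ => ?_
    rw [← aux_sum k ℓ h i, sub_mul, Finset.sum_mul, ← nsmul_eq_mul, ← Finset.sum_const,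
      ← Finset.sum_sub_distrib]
    refine Finset.sum_congr rfl fun d _ => ?_
    split_ifs <;> simp
  simp only [auxG]
  rw [Finset.sum_sub_distrib, ← Finset.mul_sum, ← Finset.mul_sum, e1, e0, Finset.sum_sub_distrib]
  field_simp

theorem aux_generic {Ω : Type*} [MeasurableSpace Ω] (P : Measure Ω)
    [IsProbabilityMeasure P] (m : ℕ) (hm : 2 ≤ m) (X : Fin m → Ω → ℝ) (μ : Fin m → ℝ)
    (hX : ∀ j, MemLp (X j) 2 P) (hμ : ∀ j, ∫ ω, X j ω ∂P = μ j)
    (hI : iIndepFun X P) :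
    (∫ ω, ((m : ℝ) * ((m : ℝ) - 1))⁻¹ * ∑ j, (X j ω - (m : ℝ)⁻¹ * ∑ i, X i ω) ^ 2 ∂P)
      - variance (fun ω => (m : ℝ)⁻¹ * ∑ i, X i ω) P
      = ((m : ℝ) * ((m : ℝ) - 1))⁻¹ * ∑ j, (μ j - (m : ℝ)⁻¹ * ∑ i, μ i) ^ 2 := by
  have hm2 : (2 : ℝ) ≤ m := by exact_mod_cast hm
  have hm0 : (m : ℝ) ≠ 0 := by linarith
  have hm1 : (m : ℝ) - 1 ≠ 0 := by linarith
  have alg : ∀ x : Fin m → ℝ, ∑ j, (x j - (m : ℝ)⁻¹ * ∑ i, x i) ^ 2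
      = ∑ j, (x j) ^ 2 - (m : ℝ)⁻¹ * (∑ i, x i) ^ 2 := by
    intro x
    simp only [sub_sq, Finset.sum_add_distrib, Finset.sum_sub_distrib, Finset.sum_const,
      Finset.card_univ, Fintype.card_fin, nsmul_eq_mul, ← Finset.sum_mul, ← Finset.mul_sum]
    field_simp
    ring
  have hS : MemLp (∑ i, X i) 2 P := memLp_finsetSum' _ fun i _ => hX i
  have hv : variance (∑ i, X i) P = ∑ i, variance (X i) P :=
    IndepFun.variance_sum (fun i _ => hX i) (fun i _ j _ hij => hI.indepFun hij)
  have hSm : ∫ ω, (∑ i, X i) ω ∂P = ∑ i, μ i := by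
    simp only [Finset.sum_apply]
    rw [integral_finsetSum _ fun i _ => (hX i).integrable one_le_two]
    simp [hμ]
  have hS2 := variance_eq_sub hS
  have hX2 : ∀ j, ∫ ω, (X j ω) ^ 2 ∂P = variance (X j) P + μ j ^ 2 := by
    intro j
    have := variance_eq_sub (hX j)
    rw [hμ] at this
    simp only [Pi.pow_apply] at this
    linarith
  rw [hSm, hv] at hS2
  simp only [Pi.pow_apply, Finset.sum_apply] at hS2
  have hvar : variance (fun ω => (m : ℝ)⁻¹ * ∑ i, X i ω) P
      = (m : ℝ)⁻¹ ^ 2 * ∑ i, variance (X i) P := by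
    rw [variance_const_mul, ← hv]
    congr 2
    ext ω; simp
  have hSi : Integrable (fun ω => (∑ i, X i ω) ^ 2) P := by
    have := hS.integrable_sq
    simpa using this
  simp only [alg]
  rw [hvar, integral_const_mul, integral_sub
    (integrable_finsetSum _ fun j _ => (hX j).integrable_sq) (hSi.const_mul _),
    integral_finsetSum _ fun j _ => (hX j).integrable_sq, integral_const_mul]
  simp only [hX2, Finset.sum_add_distrib]
  rw [show ∫ ω, (∑ i, X i ω) ^ 2 ∂P = ∑ i, variance (X i) P + (∑ i, μ i) ^ 2 by linarith]
  field_simp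
  ring

/-- Under Assumption 1 with `m ≥ 2`, the Imai variance estimator
`V̂ᴵᴹₙ` has bias `(1/(m(m−1))) Σⱼ (Δ_{j,n} − Δₙ)² ≥ 0`; in particular it is an
upward-biased estimator of `Var[Δ̂ₙ]`. -/
theorem imai_bias {Ω : Type*} [MeasurableSpace Ω] (P : Measure Ω)
    [IsProbabilityMeasure P] (m k ℓ : ℕ) (hm : 2 ≤ m) (hℓ : 0 < ℓ) (hℓk : ℓ < k)
    (Y1 Y0 : Fin m → Fin k → ℝ) (D : Ω → Fin m → Fin k → Bool)
    (hD : Assumption1 P m k ℓ D) :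
    (∫ ω, hatVIM m k ℓ Y1 Y0 D ω ∂P) - variance (hatDelta m k ℓ Y1 Y0 D) P
        = ((m : ℝ) * ((m : ℝ) - 1))⁻¹ *
            ∑ j, (DeltaJ m k Y1 Y0 j - Delta m k Y1 Y0) ^ 2 ∧
      0 ≤ ((m : ℝ) * ((m : ℝ) - 1))⁻¹ *
            ∑ j, (DeltaJ m k Y1 Y0 j - Delta m k Y1 Y0) ^ 2 ∧
      variance (hatDelta m k ℓ Y1 Y0 D) P ≤ ∫ ω, hatVIM m k ℓ Y1 Y0 D ω ∂P := by
  have hprob := aux_prob k ℓ hℓk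
  obtain ⟨hDm, hmap⟩ := hD
  have hDj : ∀ j, Measurable (fun ω => D ω j) := fun j => (measurable_pi_apply j).comp hDm
  have hmapj : ∀ j, Measure.map (fun ω => D ω j) P = uniformFinset (assignSet k ℓ) := by
    intro j
    have h1 := (measurePreserving_eval
      (fun _ : Fin m => uniformFinset (assignSet k ℓ)) j).map_eq
    rw [← hmap, Measure.map_map (measurable_pi_apply j) hDm] at h1
    exact h1
  have hgm : ∀ j, Measurable (auxG k ℓ (Y1 j) (Y0 j)) := fun j => Measurable.of_discrete
  have hI0 : iIndepFun (fun j ω => D ω j) P := by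
    rw [iIndepFun_iff_map_fun_eq_pi_map fun j => (hDj j).aemeasurable]
    simp only [hmapj]
    exact hmap
  have hI : iIndepFun (fun j ω => auxG k ℓ (Y1 j) (Y0 j) (D ω j)) P :=
    hI0.comp (fun j => auxG k ℓ (Y1 j) (Y0 j)) hgm
  have hL : ∀ j, MemLp (fun ω => auxG k ℓ (Y1 j) (Y0 j) (D ω j)) 2 P := by
    intro j
    have h1 : MemLp (auxG k ℓ (Y1 j) (Y0 j)) 2 (Measure.map (fun ω => D ω j) P) := by
      rw [hmapj]
      exact MemLp.of_discrete
    exact h1.comp_of_map (hDj j).aemeasurable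
  have hM : ∀ j, ∫ ω, auxG k ℓ (Y1 j) (Y0 j) (D ω j) ∂P = DeltaJ m k Y1 Y0 j := by
    intro j
    rw [DeltaJ, ← aux_mean k ℓ hℓ hℓk, ← hmapj j,
      integral_map (hDj j).aemeasurable (hgm j).aestronglyMeasurable]
  have hh : hatDelta m k ℓ Y1 Y0 D
      = fun ω => (m : ℝ)⁻¹ * ∑ j, auxG k ℓ (Y1 j) (Y0 j) (D ω j) := by
    ext ω
    simp only [hatDelta, auxG, Finset.sum_sub_distrib, ← Finset.mul_sum, mul_inv]
    ring
  have hd : Delta m k Y1 Y0 = (m : ℝ)⁻¹ * ∑ j, DeltaJ m k Y1 Y0 j := by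
    simp only [Delta, DeltaJ, ← Finset.mul_sum, mul_inv]
    ring
  have hmain := aux_generic P m hm _ _ hL hM hI
  rw [← hd, ← hh] at hmain
  have hV : (∫ ω, hatVIM m k ℓ Y1 Y0 D ω ∂P) = ∫ ω, ((m : ℝ) * ((m : ℝ) - 1))⁻¹ *
      ∑ j, (auxG k ℓ (Y1 j) (Y0 j) (D ω j)
        - (m : ℝ)⁻¹ * ∑ i, auxG k ℓ (Y1 i) (Y0 i) (D ω i)) ^ 2 ∂P := by
    simp only [hatVIM, hh]
    rfl
  rw [← hV] at hmain
  have hm2 : (2 : ℝ) ≤ m := by exact_mod_cast hm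
  have hnn : 0 ≤ ((m : ℝ) * ((m : ℝ) - 1))⁻¹ *
            ∑ j, (DeltaJ m k Y1 Y0 j - Delta m k Y1 Y0) ^ 2 := by
    refine mul_nonneg (inv_nonneg.mpr (mul_nonneg (by linarith) (by linarith))) ?_
    exact Finset.sum_nonneg fun _ _ => sq_nonneg _
  exact ⟨hmain, hnn, by linarith⟩

end DesignBased
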